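/- arXiv:2202.02948 — 2 statements merged into one kernel-verified Lean document; each statement's English description precedes it below -/
import Mathlib

section
/- Let n, h, H be as in the grid-interpolation setup. Let θ ∈ [0,1] be a grid point (θ = j/n for some integer 0 ≤ j ≤ n) and let τ ∈ [0,θ]. Then H(τ,θ) ≥ (1−z(τ))·H(τ̄,θ) + z(τ)·H(τ̂,θ) − 3/(2n²). -/
/-- Lower grid point: `x̄ = ⌊nx⌋/n` for `x ∈ [0,1)`, and `1̄ = 1`. -/
noncomputable def gbar (n : ℕ) (x : ℝ) : ℝ :=
  if x = 1 then 1 else (⌊(n : ℝ) * x⌋ : ℝ) / n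

/-- Upper grid point: `x̂ = x̄ + 1/n` for `x ∈ [0,1)`, and `1̂ = 1`. -/
noncomputable def ghat (n : ℕ) (x : ℝ) : ℝ :=
  if x = 1 then 1 else (⌊(n : ℝ) * x⌋ : ℝ) / n + 1 / n

/-- Interpolation weight: `z(x) = n·(x − x̄)` for `x ∈ [0,1)`, and `z(1) = 0`. -/
noncomputable def gz (n : ℕ) (x : ℝ) : ℝ :=
  if x = 1 then 0 else (n : ℝ) * (x - (⌊(n : ℝ) * x⌋ : ℝ) / n)

/-- `H(τ,θ) = θ·h(τ,θ) − ∫_τ^θ h(τ,y) dy` (signed integral). -/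
noncomputable def gridH (h : ℝ → ℝ → ℝ) (τ θ : ℝ) : ℝ :=
  θ * h τ θ - ∫ y in τ..θ, h τ y

/-- Bilinear interpolation of a two-variable function at the grid corners. -/
noncomputable def interp2 (n : ℕ) (F : ℝ → ℝ → ℝ) (τ θ : ℝ) : ℝ :=
  (1 - gz n τ) * (1 - gz n θ) * F (gbar n τ) (gbar n θ)
  + (1 - gz n τ) * gz n θ * F (gbar n τ) (ghat n θ)
  + gz n τ * (1 - gz n θ) * F (ghat n τ) (gbar n θ)
  + gz n τ * gz n θ * F (ghat n τ) (ghat n θ)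

theorem gz_grid {n : ℕ} (hn : 0 < n) (j : ℕ) : gz n ((j : ℝ) / n) = 0 := by
  have hn' : (n : ℝ) ≠ 0 := by positivity
  simp [gz, mul_div_cancel₀ _ hn']

theorem gbar_grid {n : ℕ} (hn : 0 < n) (j : ℕ) : gbar n ((j : ℝ) / n) = (j : ℝ) / n := by
  have hn' : (n : ℝ) ≠ 0 := by positivity
  unfold gbar
  split_ifs with h
  · exact h.symm
  · simp [mul_div_cancel₀ _ hn']

/-- The three grid functions on the half-open cell `[k/n, (k+1)/n)`. -/
theorem grid_cell {n k : ℕ} (hn : 0 < n) (hk : k < n) {x : ℝ}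
    (hx : x ∈ Set.Ico ((k : ℝ) / n) (((k : ℝ) + 1) / n)) :
    gbar n x = (k : ℝ) / n ∧ ghat n x = ((k : ℝ) + 1) / n ∧ gz n x = n * x - k := by
  have hn' : (0 : ℝ) < n := by positivity
  have hk' : (k : ℝ) + 1 ≤ n := by exact_mod_cast hk
  have h1 : x ≠ 1 := (hx.2.trans_le ((div_le_one hn').2 hk')).ne
  have hlo := (div_le_iff₀ hn').1 hx.1
  have hhi := (lt_div_iff₀ hn').1 hx.2
  have hfl : ⌊(n : ℝ) * x⌋ = (k : ℤ) := by
    rw [Int.floor_eq_iff]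
    push_cast
    constructor <;> linarith
  refine ⟨?_, ?_, ?_⟩
  · simp [gbar, h1, hfl]
  · simp [ghat, h1, hfl, add_div]
  · simp only [gz, h1, if_false, hfl, Int.cast_natCast]
    field_simp

/-- Integral of an affine function in Newton form. -/
theorem integral_affine (c m p u v : ℝ) :
    ∫ y in u..v, (c + m * (y - p)) = (v - u) * (c + m * ((u + v) / 2 - p)) := by
  rw [intervalIntegral.integral_add (by simp)
    ((by fun_prop : Continuous fun y : ℝ => m * (y - p)).intervalIntegrable _ _),
    intervalIntegral.integral_const_mul, intervalIntegral.integral_sub (by simp) (by simp)]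
  simp
  ring

/-- **Interpolation bound in the first coordinate.**
For `h` equal to the bilinear interpolation of its grid values, nondecreasing in each
coordinate and step-Lipschitz at grid points, if `θ` is a grid point and `τ ∈ [0,θ]`,
then `H(τ,θ) ≥ (1−z(τ))·H(τ̄,θ) + z(τ)·H(τ̂,θ) − 3/(2n²)`. -/
theorem gridH_interp_first
    (n : ℕ) (hn : 0 < n) (h : ℝ → ℝ → ℝ)
    (hinterp : ∀ τ ∈ Set.Icc (0:ℝ) 1, ∀ θ ∈ Set.Icc (0:ℝ) 1,
      h τ θ = (1 - gz n τ) * (1 - gz n θ) * h (gbar n τ) (gbar n θ)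
        + (1 - gz n τ) * gz n θ * h (gbar n τ) (ghat n θ)
        + gz n τ * (1 - gz n θ) * h (ghat n τ) (gbar n θ)
        + gz n τ * gz n θ * h (ghat n τ) (ghat n θ))
    (hmono_left : ∀ θ ∈ Set.Icc (0:ℝ) 1, MonotoneOn (fun τ => h τ θ) (Set.Icc 0 1))
    (hmono_right : ∀ τ ∈ Set.Icc (0:ℝ) 1, MonotoneOn (fun θ => h τ θ) (Set.Icc 0 1))
    (hlip_right : ∀ i j : ℕ, i ≤ n → j + 1 ≤ n →
      h ((i:ℝ)/n) (((j:ℝ)+1)/n) ≤ h ((i:ℝ)/n) ((j:ℝ)/n) + 4 / n)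
    (hlip_left : ∀ i j : ℕ, i + 1 ≤ n → j ≤ n →
      h (((i:ℝ)+1)/n) ((j:ℝ)/n) ≤ h ((i:ℝ)/n) ((j:ℝ)/n) + 4 / n)
    (τ θ : ℝ)
    (hθgrid : ∃ j : ℕ, j ≤ n ∧ θ = (j:ℝ)/n)
    (hτ : τ ∈ Set.Icc 0 θ) :
    (1 - gz n τ) * gridH h (gbar n τ) θ + gz n τ * gridH h (ghat n τ) θ
        - 3 / (2 * (n:ℝ)^2)
      ≤ gridH h τ θ := by
  have hn' : (0 : ℝ) < n := by positivity
  obtain ⟨l, hl, rfl⟩ := hθgrid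
  have hθ1 : (l : ℝ) / n ≤ 1 := (div_le_one hn').2 (by exact_mod_cast hl)
  obtain ⟨hτ0, hτθ⟩ := hτ
  rcases (hτθ.trans hθ1).eq_or_lt with rfl | hτ1
  · have : (0 : ℝ) ≤ 3 / (2 * (n : ℝ) ^ 2) := by positivity
    simp only [gz, gbar, if_true]
    linarith
  obtain ⟨k, hkdef⟩ : ∃ k : ℕ, ⌊(n : ℝ) * τ⌋₊ = k := ⟨_, rfl⟩
  obtain ⟨hklo, hkhi⟩ := (Nat.floor_eq_iff (by positivity)).1 hkdef
  have hkn : k < n := by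
    have : (k : ℝ) < n := by nlinarith
    exact_mod_cast this
  have hcell : τ ∈ Set.Ico ((k : ℝ) / n) (((k : ℝ) + 1) / n) :=
    ⟨(div_le_iff₀ hn').2 (by linarith), (lt_div_iff₀ hn').2 (by linarith)⟩
  obtain ⟨hbar, hhat, hz⟩ := grid_cell hn hkn hcell
  have hbgrid : ((k : ℝ) + 1) / n = ((k + 1 : ℕ) : ℝ) / n := by push_cast; rfl
  have hb1 : ((k : ℝ) + 1) / n ≤ 1 := (div_le_one hn').2 (by exact_mod_cast hkn)
  have hgrid : ∀ i : ℕ, i ≤ n → (i : ℝ) / n ∈ Set.Icc (0 : ℝ) 1 := fun i hi =>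
    ⟨by positivity, (div_le_one hn').2 (by exact_mod_cast hi)⟩
  have hrow : ∀ i : ℕ, i ≤ n → ∀ y ∈ Set.Icc (0 : ℝ) 1, h ((i : ℝ) / n) y =
      (1 - gz n y) * h ((i : ℝ) / n) (gbar n y) + gz n y * h ((i : ℝ) / n) (ghat n y) := by
    intro i hi y hy
    have := hinterp _ (hgrid i hi) y hy
    rw [gz_grid hn, gbar_grid hn] at this
    linarith
  have hrowcell : ∀ i : ℕ, i ≤ n → ∀ y ∈ Set.Icc ((k : ℝ) / n) (((k : ℝ) + 1) / n),
      h ((i : ℝ) / n) y = h ((i : ℝ) / n) ((k : ℝ) / n) +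
        n * (h ((i : ℝ) / n) (((k : ℝ) + 1) / n) - h ((i : ℝ) / n) ((k : ℝ) / n)) *
          (y - (k : ℝ) / n) := by
    intro i hi y hy
    rcases hy.2.eq_or_lt with rfl | hlt
    · field_simp
      ring
    · have hyI : y ∈ Set.Icc (0 : ℝ) 1 :=
        ⟨(hgrid k hkn.le).1.trans hy.1, hy.2.trans hb1⟩
      obtain ⟨e1, e2, e3⟩ := grid_cell hn hkn ⟨hy.1, hlt⟩
      rw [hrow i hi y hyI, e1, e2, e3]
      field_simp
      ring
  have hmix : ∀ y ∈ Set.Icc (0 : ℝ) 1, h τ y =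
      (1 - gz n τ) * h ((k : ℝ) / n) y + gz n τ * h (((k : ℝ) + 1) / n) y := by
    intro y hy
    rw [hinterp τ ⟨hτ0, hτ1.le⟩ y hy, hrow k hkn.le y hy, hbgrid, hrow (k + 1) hkn y hy, hbar, hhat,
      hbgrid]
    ring
  have hint : ∀ i : ℕ, i ≤ n → ∀ u ∈ Set.Icc (0 : ℝ) 1, ∀ v ∈ Set.Icc (0 : ℝ) 1,
      IntervalIntegrable (h ((i : ℝ) / n)) MeasureTheory.volume u v := by
    intro i hi u hu v hv
    exact ((hmono_right _ (hgrid i hi)).mono (Set.uIcc_subset_Icc hu hv)).intervalIntegrable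
  have hτI : τ ∈ Set.Icc (0 : ℝ) 1 := ⟨hτ0, hτ1.le⟩
  have hθI := hgrid l hl
  have haI := hgrid k hkn.le
  have hbI := hgrid (k + 1) hkn
  have hia := hint k hkn.le
  have hib := hint (k + 1) hkn
  have hca := hrowcell k hkn.le
  have hcb := hrowcell (k + 1) hkn
  have hlr2 := hlip_right (k + 1) k hkn hkn
  have hll1 := hlip_left k k hkn hkn.le
  have hll2 := hlip_left k (k + 1) hkn hkn
  rw [← hbgrid] at hbI hib hcb hlr2 hll2
  have hInt : ∫ y in τ..(l : ℝ) / n, h τ y =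
      (1 - gz n τ) * (∫ y in τ..(l : ℝ) / n, h ((k : ℝ) / n) y)
        + gz n τ * ∫ y in τ..(l : ℝ) / n, h (((k : ℝ) + 1) / n) y := by
    rw [← intervalIntegral.integral_const_mul, ← intervalIntegral.integral_const_mul,
      ← intervalIntegral.integral_add ((hia _ hτI _ hθI).const_mul _)
        ((hib _ hτI _ hθI).const_mul _)]
    exact intervalIntegral.integral_congr fun y hy => hmix y (Set.uIcc_subset_Icc hτI hθI hy)
  have hsplita := intervalIntegral.integral_add_adjacent_intervals
    (hia _ haI _ hτI) (hia _ hτI _ hθI)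
  have hsplitb := intervalIntegral.integral_add_adjacent_intervals
    (hib _ hτI _ hbI) (hib _ hbI _ hθI)
  have hcellI : ∀ {u v : ℝ}, u ∈ Set.Icc ((k : ℝ) / n) (((k : ℝ) + 1) / n) →
      v ∈ Set.Icc ((k : ℝ) / n) (((k : ℝ) + 1) / n) →
      Set.uIcc u v ⊆ Set.Icc ((k : ℝ) / n) (((k : ℝ) + 1) / n) :=
    fun hu hv => Set.uIcc_subset_Icc hu hv
  have hab := hcell.1.trans hcell.2.le
  have hIa := (intervalIntegral.integral_congr fun y hy =>
    hca y (hcellI ⟨le_rfl, hab⟩ ⟨hcell.1, hcell.2.le⟩ hy)).trans (integral_affine _ _ _ _ τ)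
  have hIb := (intervalIntegral.integral_congr fun y hy =>
    hcb y (hcellI ⟨hcell.1, hcell.2.le⟩ ⟨hab, le_rfl⟩ hy)).trans (integral_affine _ _ _ τ _)
  unfold gridH
  rw [hbar, hhat, hInt, hmix _ hθI, ← hsplita]
  rw [hIb] at hsplitb
  rw [hIa, ← sub_eq_iff_eq_add'.2 hsplitb.symm]
  have hτz : τ = (k + gz n τ) / n := by rw [hz]; field_simp; ring
  have hz0 : 0 ≤ gz n τ := by rw [hz]; linarith
  have hz1 : gz n τ ≤ 1 := by rw [hz]; linarith
  generalize (∫ y in τ..(l : ℝ) / n, h ((k : ℝ) / n) y) = I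
  generalize (∫ y in ((k : ℝ) + 1) / n..(l : ℝ) / n, h (((k : ℝ) + 1) / n) y) = J
  clear hz
  generalize gz n τ = z at *
  subst hτz
  generalize h ((k : ℝ) / n) ((l : ℝ) / n) = P
  generalize h (((k : ℝ) + 1) / n) ((l : ℝ) / n) = Q
  generalize h ((k : ℝ) / n) ((k : ℝ) / n) = A at *
  generalize h (((k : ℝ) + 1) / n) (((k : ℝ) + 1) / n) = B at *
  generalize h (((k : ℝ) + 1) / n) ((k : ℝ) / n) = C at *
  generalize h ((k : ℝ) / n) (((k : ℝ) + 1) / n) = D at *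
  have hloss : (B - A) - z / 2 * (D - A) - (1 - z) / 2 * (B - C) ≤ 6 / n := by
    have h1 := mul_le_mul_of_nonneg_left (show B - A - 4 / n ≤ D - A by linarith) hz0
    have h2 := mul_le_mul_of_nonneg_left (show B - A - 4 / n ≤ B - C by linarith)
      (sub_nonneg.2 hz1)
    have h3 : (6 : ℝ) / n = 4 / n * (3 / 2) := by ring
    rw [h3]
    linarith
  have hquarter : z * (1 - z) ≤ 1 / 4 := by nlinarith [sq_nonneg (z - 1 / 2)]
  have hweight : 0 ≤ z * (1 - z) := mul_nonneg hz0 (sub_nonneg.2 hz1)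
  have hprod : z * (1 - z) / n * ((B - A) - z / 2 * (D - A) - (1 - z) / 2 * (B - C))
      ≤ 3 / (2 * (n : ℝ) ^ 2) :=
    calc _ ≤ z * (1 - z) / n * (6 / n) := by gcongr
      _ ≤ 1 / 4 / n * (6 / n) := by gcongr
      _ = 3 / (2 * (n : ℝ) ^ 2) := by field_simp; norm_num
  refine le_of_sub_nonneg ((sub_nonneg.2 hprod).trans_eq ?_)
  field_simp
  ring
end

section
/- Let n, h, H be as in the grid-interpolation setup. Define Φ1(τ,θ) = H(τ,θ) + 1 − θ = θ·h(τ,θ) − ∫_{τ}^{θ} h(τ,y) dy + 1 − θ, and let Φ̃1(τ,θ) = (1−z(τ))(1−z(θ))·Φ1(τ̄,θ̄) + (1−z(τ))z(θ)·Φ1(τ̄,θ̂) + z(τ)(1−z(θ))·Φ1(τ̂,θ̄) + z(τ)z(θ)·Φ1(τ̂,θ̂). Then for all 0 ≤ τ ≤ θ ≤ 1: Φ1(τ,θ) ≥ Φ̃1(τ,θ) − 5/(2n²). -/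
/-- `Φ1(τ,θ) = H(τ,θ) + 1 − θ = θ·h(τ,θ) − ∫_τ^θ h(τ,y) dy + 1 − θ`. -/
noncomputable def Phi1 (h : ℝ → ℝ → ℝ) (τ θ : ℝ) : ℝ :=
  gridH h τ θ + 1 - θ

theorem exists_grid_cell {n : ℕ} (hn : 0 < n) {x : ℝ} (hx0 : 0 ≤ x) (hx1 : x ≤ 1) :
    ∃ i : ℕ, i + 1 ≤ n ∧ x ∈ Set.Icc ((i : ℝ) / n) (((i : ℝ) + 1) / n) := by
  have hn' : (0 : ℝ) < n := by exact_mod_cast hn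
  rcases hx1.eq_or_lt with rfl | hlt
  · obtain ⟨m, rfl⟩ : ∃ m, n = m + 1 := ⟨n - 1, by omega⟩
    refine ⟨m, le_rfl, ?_, ?_⟩
    · rw [div_le_one hn']; push_cast; linarith
    · rw [le_div_iff₀ hn']; push_cast; linarith
  · have hnx : 0 ≤ (n : ℝ) * x := by positivity
    refine ⟨⌊(n : ℝ) * x⌋₊, ?_, ?_, ?_⟩
    · rw [Nat.succ_le_iff, Nat.floor_lt hnx]
      nlinarith
    · rw [div_le_iff₀ hn', mul_comm x]
      exact Nat.floor_le hnx
    · rw [le_div_iff₀ hn', mul_comm x]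
      exact (Nat.lt_floor_add_one _).le

/-- On a closed grid cell, interpolation through `gbar` and `ghat` is affine interpolation
between the endpoints of the cell, including at its right endpoint. -/
theorem grid_interp_eq {n i : ℕ} (hi : i + 1 ≤ n) {x : ℝ}
    (hx : x ∈ Set.Icc ((i : ℝ) / n) (((i : ℝ) + 1) / n)) (F : ℝ → ℝ) :
    (1 - gz n x) * F (gbar n x) + gz n x * F (ghat n x)
      = (1 - (n * x - i)) * F ((i : ℝ) / n) + (n * x - i) * F (((i : ℝ) + 1) / n) := by
  have hn : (0 : ℝ) < n := by exact_mod_cast (Nat.succ_pos i).trans_le hi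
  have hin : (i : ℝ) + 1 ≤ n := by exact_mod_cast hi
  obtain ⟨h0, h1⟩ := hx
  rw [div_le_iff₀ hn] at h0
  rcases h1.eq_or_lt with heq | hlt
  · have hw : (n : ℝ) * x = i + 1 := by rw [heq]; field_simp
    by_cases hx1 : x = 1
    · rw [← heq, hw]
      simp [gz, gbar, hx1]
    · have hfl : ⌊(n : ℝ) * x⌋ = (i : ℤ) + 1 := by
        rw [hw, Int.floor_eq_iff]; push_cast; constructor <;> linarith
      have hz : gz n x = 0 := by
        simp only [gz, hx1, if_false, hfl]; push_cast; rw [heq]; simp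
      have hb : gbar n x = ((i : ℝ) + 1) / n := by
        simp only [gbar, hx1, if_false, hfl]; push_cast; rfl
      rw [hz, hb, hw]; ring
  · rw [lt_div_iff₀ hn] at hlt
    have hx1 : x ≠ 1 := by rintro rfl; linarith
    have hfl : ⌊(n : ℝ) * x⌋ = (i : ℤ) := by
      rw [Int.floor_eq_iff]; push_cast; constructor <;> linarith
    have hz : gz n x = n * x - i := by
      simp only [gz, hx1, if_false, hfl]; push_cast; field_simp
    have hb : gbar n x = (i : ℝ) / n := by
      simp only [gbar, hx1, if_false, hfl]; push_cast; rfl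
    have hh : ghat n x = ((i : ℝ) + 1) / n := by
      simp only [ghat, hx1, if_false, hfl]; push_cast; ring
    rw [hz, hb, hh]

theorem interp2_eq {n i j : ℕ} (hi : i + 1 ≤ n) (hj : j + 1 ≤ n) {x y : ℝ}
    (hx : x ∈ Set.Icc ((i : ℝ) / n) (((i : ℝ) + 1) / n))
    (hy : y ∈ Set.Icc ((j : ℝ) / n) (((j : ℝ) + 1) / n)) (F : ℝ → ℝ → ℝ) :
    interp2 n F x y
      = (1 - (n * x - i)) * ((1 - (n * y - j)) * F ((i : ℝ) / n) ((j : ℝ) / n)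
          + (n * y - j) * F ((i : ℝ) / n) (((j : ℝ) + 1) / n))
        + (n * x - i) * ((1 - (n * y - j)) * F (((i : ℝ) + 1) / n) ((j : ℝ) / n)
          + (n * y - j) * F (((i : ℝ) + 1) / n) (((j : ℝ) + 1) / n)) := by
  rw [← grid_interp_eq hj hy (F ((i : ℝ) / n)), ← grid_interp_eq hj hy (F (((i : ℝ) + 1) / n)),
    ← grid_interp_eq hi hx (fun u => (1 - gz n y) * F u (gbar n y) + gz n y * F u (ghat n y)),
    interp2]
  ring

theorem integral_of_affine_on {f : ℝ → ℝ} {c x m : ℝ}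
    (hf : ∀ y ∈ Set.uIcc c x, f y = f c + m * (y - c)) :
    ∫ y in c..x, f y = (x - c) * (f c + f x) / 2 := by
  rw [intervalIntegral.integral_congr hf, hf x Set.right_mem_uIcc,
    intervalIntegral.integral_add (Continuous.intervalIntegrable (by fun_prop) _ _)
      (Continuous.intervalIntegrable (by fun_prop) _ _),
    intervalIntegral.integral_const, intervalIntegral.integral_const_mul,
    intervalIntegral.integral_sub (Continuous.intervalIntegrable (by fun_prop) _ _)
      (Continuous.intervalIntegrable (by fun_prop) _ _), integral_id,
    intervalIntegral.integral_const]
  simp only [smul_eq_mul]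
  ring

theorem quadrature_error_bound {n s p q W V : ℝ} (hn' : 0 < n) (hs0 : 0 ≤ s) (hs1 : s ≤ 1)
    (hdiag : q - p ≤ 8 / n) (hW : s / n * p ≤ W) (hV : V ≤ (1 - s) / n * q) :
    - 2 / n ^ 2 ≤ (1 - s) * W - s * V := by
  have h1 := mul_le_mul_of_nonneg_left hW (sub_nonneg.2 hs1)
  have h2 := mul_le_mul_of_nonneg_left hV hs0
  have h3 := mul_le_mul_of_nonneg_left hdiag
    (show 0 ≤ s * (1 - s) / n from div_nonneg (mul_nonneg hs0 (sub_nonneg.2 hs1)) hn'.le)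
  have h4 : s * (1 - s) / n * (8 / n) ≤ 2 / n ^ 2 := by
    rw [div_mul_div_comm, ← sq]
    gcongr
    nlinarith [sq_nonneg (2 * s - 1)]
  have h5 : (1 - s) * (s / n * p) - s * ((1 - s) / n * q)
    = - (s * (1 - s) / n * (q - p)) := by ring
  have h6 : - 2 / n ^ 2 = - (2 / n ^ 2) := by ring
  linarith

theorem interp_curvature_bound {n s t p q : ℝ} (hn' : 0 < n) (hs0 : 0 ≤ s) (hs1 : s ≤ 1)
    (ht0 : 0 ≤ t) (ht1 : t ≤ 1) (hlipa : p ≤ 4 / n) (hlipb : q ≤ 4 / n) :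
    t * (1 - t) / (2 * n) * ((1 - s) * p + s * q) ≤ 1 / (2 * n ^ 2) := by
  have h1 : (1 - s) * p + s * q ≤ 4 / n := by
    linear_combination mul_le_mul_of_nonneg_left hlipa (sub_nonneg.2 hs1)
      + mul_le_mul_of_nonneg_left hlipb hs0
  refine (mul_le_mul_of_nonneg_left h1
    (div_nonneg (mul_nonneg ht0 (sub_nonneg.2 ht1)) (by positivity))).trans ?_
  rw [div_mul_div_comm, mul_assoc 2, ← sq]
  gcongr
  nlinarith [sq_nonneg (2 * t - 1)]

/-- **Interpolation bound for `Φ1`.**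
For `h` equal to the bilinear interpolation of its grid values, nondecreasing in each
coordinate and step-Lipschitz at grid points, and `Φ̃1` the bilinear interpolation of
`Φ1` at the grid corners, for all `0 ≤ τ ≤ θ ≤ 1`: `Φ1(τ,θ) ≥ Φ̃1(τ,θ) − 5/(2n²)`. -/
theorem Phi1_interp_bound
    (n : ℕ) (hn : 0 < n) (h : ℝ → ℝ → ℝ)
    (hinterp : ∀ τ ∈ Set.Icc (0:ℝ) 1, ∀ θ ∈ Set.Icc (0:ℝ) 1,
      h τ θ = (1 - gz n τ) * (1 - gz n θ) * h (gbar n τ) (gbar n θ)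
        + (1 - gz n τ) * gz n θ * h (gbar n τ) (ghat n θ)
        + gz n τ * (1 - gz n θ) * h (ghat n τ) (gbar n θ)
        + gz n τ * gz n θ * h (ghat n τ) (ghat n θ))
    (hmono_left : ∀ θ ∈ Set.Icc (0:ℝ) 1, MonotoneOn (fun τ => h τ θ) (Set.Icc 0 1))
    (hmono_right : ∀ τ ∈ Set.Icc (0:ℝ) 1, MonotoneOn (fun θ => h τ θ) (Set.Icc 0 1))
    (hlip_right : ∀ i j : ℕ, i ≤ n → j + 1 ≤ n →
      h ((i:ℝ)/n) (((j:ℝ)+1)/n) ≤ h ((i:ℝ)/n) ((j:ℝ)/n) + 4 / n)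
    (hlip_left : ∀ i j : ℕ, i + 1 ≤ n → j ≤ n →
      h (((i:ℝ)+1)/n) ((j:ℝ)/n) ≤ h ((i:ℝ)/n) ((j:ℝ)/n) + 4 / n)
    (τ θ : ℝ) (hτ0 : 0 ≤ τ) (hτθ : τ ≤ θ) (hθ1 : θ ≤ 1) :
    interp2 n (Phi1 h) τ θ - 5 / (2 * (n:ℝ)^2) ≤ Phi1 h τ θ := by
  have hn' : (0 : ℝ) < n := by exact_mod_cast hn
  obtain ⟨i, hi, hτc⟩ := exists_grid_cell hn hτ0 (hτθ.trans hθ1)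
  obtain ⟨j, hj, hθc⟩ := exists_grid_cell hn (hτ0.trans hτθ) hθ1
  have hcell : ∀ k : ℕ, k + 1 ≤ n → (k : ℝ) / n ≤ ((k : ℝ) + 1) / n ∧
      Set.Icc ((k : ℝ) / n) (((k : ℝ) + 1) / n) ⊆ Set.Icc 0 1 := fun k hk => by
    refine ⟨by gcongr; linarith, Set.Icc_subset_Icc (by positivity) ?_⟩
    rw [div_le_one hn']; exact_mod_cast hk
  have hint : ∀ x ∈ Set.Icc (0 : ℝ) 1, ∀ u ∈ Set.Icc (0 : ℝ) 1, ∀ v ∈ Set.Icc (0 : ℝ) 1,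
      IntervalIntegrable (h x) MeasureTheory.volume u v := fun x hx u hu v hv =>
    ((hmono_right x hx).mono (Set.uIcc_subset_Icc hu hv)).intervalIntegrable
  have hfst : ∀ {k : ℕ}, k + 1 ≤ n → ∀ x ∈ Set.Icc ((k : ℝ) / n) (((k : ℝ) + 1) / n),
      ∀ y ∈ Set.Icc (0 : ℝ) 1,
      h x y = (1 - (n * x - k)) * h ((k : ℝ) / n) y + (n * x - k) * h (((k : ℝ) + 1) / n) y := by
    intro k hk x hx y hy
    obtain ⟨l, hl, hyl⟩ := exists_grid_cell hn hy.1 hy.2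
    have key : ∀ u ∈ Set.Icc ((k : ℝ) / n) (((k : ℝ) + 1) / n), _ := fun u hu =>
      (hinterp u ((hcell k hk).2 hu) y hy).trans (interp2_eq hk hl hu hyl h)
    rw [key x hx, key _ (Set.left_mem_Icc.2 (hcell k hk).1),
      key _ (Set.right_mem_Icc.2 (hcell k hk).1)]
    field_simp
    ring
  have hsnd : ∀ {k : ℕ}, k + 1 ≤ n → ∀ x ∈ Set.Icc (0 : ℝ) 1,
      ∀ y ∈ Set.Icc ((k : ℝ) / n) (((k : ℝ) + 1) / n),
      h x y = (1 - (n * y - k)) * h x ((k : ℝ) / n) + (n * y - k) * h x (((k : ℝ) + 1) / n) := by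
    intro k hk x hx y hy
    obtain ⟨l, hl, hxl⟩ := exists_grid_cell hn hx.1 hx.2
    have key : ∀ u ∈ Set.Icc ((k : ℝ) / n) (((k : ℝ) + 1) / n), _ := fun u hu =>
      (hinterp x hx u ((hcell k hk).2 hu)).trans (interp2_eq hl hk hxl hu h)
    rw [key y hy, key _ (Set.left_mem_Icc.2 (hcell k hk).1),
      key _ (Set.right_mem_Icc.2 (hcell k hk).1)]
    field_simp
    ring
  have htrap : ∀ x ∈ Set.Icc (0 : ℝ) 1, ∀ y ∈ Set.Icc ((j : ℝ) / n) (((j : ℝ) + 1) / n),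
      ∫ u in ((j : ℝ) / n)..y, h x u = (y - (j : ℝ) / n) * (h x ((j : ℝ) / n) + h x y) / 2 := by
    intro x hx y hy
    refine integral_of_affine_on
      (m := n * (h x (((j : ℝ) + 1) / n) - h x ((j : ℝ) / n))) fun u hu => ?_
    rw [Set.uIcc_of_le hy.1] at hu
    rw [hsnd hj x hx u ⟨hu.1, hu.2.trans hy.2⟩]
    field_simp
    ring
  have hlipa := hlip_right i j (by omega) hj
  have hlipb := hlip_right (i + 1) j hi hj
  have hlip₁ := hlip_right (i + 1) i hi hi
  have hlip₂ := hlip_left i i hi (by omega)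
  push_cast at hlipb hlip₁
  have hτ := (hcell i hi).2 hτc
  have hθ := (hcell j hj).2 hθc
  have ha := (hcell i hi).2 (Set.left_mem_Icc.2 (hcell i hi).1)
  have hb := (hcell i hi).2 (Set.right_mem_Icc.2 (hcell i hi).1)
  have hc' := Set.left_mem_Icc.2 (hcell j hj).1
  have hd' := Set.right_mem_Icc.2 (hcell j hj).1
  have hc := (hcell j hj).2 hc'
  have hd := (hcell j hj).2 hd'
  have hfτ := hfst hi τ hτc
  have hsθ := hsnd hj τ hτ θ hθc
  have hTτ := htrap τ hτ θ hθc
  have hTa := htrap _ ha _ hd'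
  have hTb := htrap _ hb _ hd'
  rw [interp2_eq hi hj hτc hθc]
  simp only [Phi1, gridH]
  obtain ⟨s, hs⟩ : ∃ s, s = n * τ - i := ⟨_, rfl⟩
  obtain ⟨t, ht⟩ : ∃ t, t = n * θ - j := ⟨_, rfl⟩
  have hs0 : 0 ≤ s := by have := hτc.1; rw [div_le_iff₀ hn'] at this; linarith
  have hs1 : s ≤ 1 := by have := hτc.2; rw [le_div_iff₀ hn'] at this; linarith
  have ht0 : 0 ≤ t := by have := hθc.1; rw [div_le_iff₀ hn'] at this; linarith
  have ht1 : t ≤ 1 := by have := hθc.2; rw [le_div_iff₀ hn'] at this; linarith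
  have hτa : τ - (i : ℝ) / n = s / n := by rw [hs]; field_simp
  have hτb : ((i : ℝ) + 1) / n - τ = (1 - s) / n := by rw [hs]; field_simp; ring
  have hθj : θ = (j : ℝ) / n + t / n := by rw [ht]; field_simp; ring
  have hdj : ((j : ℝ) + 1) / n = (j : ℝ) / n + 1 / n := add_div _ _ _
  simp only [← hs, ← ht] at hfτ hsθ ⊢
  obtain ⟨a, hae⟩ : ∃ a, a = (i : ℝ) / n := ⟨_, rfl⟩
  obtain ⟨b, hbe⟩ : ∃ b, b = ((i : ℝ) + 1) / n := ⟨_, rfl⟩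
  obtain ⟨c, hce⟩ : ∃ c, c = (j : ℝ) / n := ⟨_, rfl⟩
  obtain ⟨d, hde⟩ : ∃ d, d = ((j : ℝ) + 1) / n := ⟨_, rfl⟩
  simp only [← hae, ← hbe, ← hce, ← hde] at *
  have hcomb : ∀ u ∈ Set.Icc (0 : ℝ) 1, ∀ v ∈ Set.Icc (0 : ℝ) 1,
      ∫ y in u..v, h τ y = (1 - s) * (∫ y in u..v, h a y) + s * ∫ y in u..v, h b y := by
    intro u hu v hv
    rw [intervalIntegral.integral_congr fun y hy => hfτ y (Set.uIcc_subset_Icc hu hv hy),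
      intervalIntegral.integral_add ((hint a ha u hu v hv).const_mul _)
        ((hint b hb u hu v hv).const_mul _),
      intervalIntegral.integral_const_mul, intervalIntegral.integral_const_mul]
  have hadd : ∀ x ∈ Set.Icc (0 : ℝ) 1, ∀ u ∈ Set.Icc (0 : ℝ) 1, ∀ v ∈ Set.Icc (0 : ℝ) 1,
      ∀ w ∈ Set.Icc (0 : ℝ) 1,
      ∫ y in u..w, h x y = (∫ y in u..v, h x y) + ∫ y in v..w, h x y :=
    fun x hx u hu v hv w hw => (intervalIntegral.integral_add_adjacent_intervals
      (hint x hx u hu v hv) (hint x hx v hv w hw)).symm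
  have hW : s / n * h a a ≤ ∫ y in a..τ, h a y := by
    rw [← hτa, ← smul_eq_mul, ← intervalIntegral.integral_const]
    exact intervalIntegral.integral_mono_on hτc.1 (by simp) (hint a ha a ha τ hτ)
      fun y hy => hmono_right a ha ha ⟨ha.1.trans hy.1, hy.2.trans hτ.2⟩ hy.1
  have hV : ∫ y in τ..b, h b y ≤ (1 - s) / n * h b b := by
    rw [← hτb, ← smul_eq_mul, ← intervalIntegral.integral_const]
    exact intervalIntegral.integral_mono_on hτc.2 (hint b hb τ hτ b hb) (by simp)
      fun y hy => hmono_right b hb ⟨hτ0.trans hy.1, hy.2.trans hb.2⟩ hb hy.2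
  rw [hadd τ hτ τ hτ c hc θ hθ, hTτ, hcomb τ hτ c hc, hadd a ha τ hτ b hb c hc,
    hadd b hb τ hτ b hb c hc, hadd a ha a ha c hc d hd, hTa, hadd b hb b hb c hc d hd, hTb,
    hadd a ha a ha τ hτ c hc, hadd a ha τ hτ b hb c hc, hsθ, hfτ c hc, hfτ d hd]
  generalize (∫ y in a..τ, h a y) = W at *
  generalize (∫ y in τ..b, h b y) = V at *
  have hmain := quadrature_error_bound hn' hs0 hs1 (p := h a a) (q := h b b)
    (by linear_combination hlip₁ + hlip₂) hW hV
  have hcurv := interp_curvature_bound hn' hs0 hs1 ht0 ht1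
    (sub_le_iff_le_add'.2 hlipa) (sub_le_iff_le_add'.2 hlipb)
  have h52 : 5 / (2 * (n : ℝ) ^ 2) = 1 / (2 * (n : ℝ) ^ 2) - (- 2 / (n : ℝ) ^ 2) := by
    field_simp; norm_num
  rw [h52]
  refine le_of_sub_nonneg ((add_nonneg (sub_nonneg.2 hcurv) (sub_nonneg.2 hmain)).trans_eq ?_)
  rw [hθj, hdj]
  field_simp
  ring
end
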